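/- Let v_1,…,v_n ∈ R^k and u_1,…,u_n ∈ R^ℓ (with k < n and ℓ ≤ n) satisfy Σ_{i=1}^n v_i v_iᵀ = I_k and Σ_{i=1}^n u_i u_iᵀ = I_ℓ. Then for every integer r with k < r ≤ n there exist nonnegative weights s_1,…,s_n, at most r of which are nonzero, such that λ_k(Σ_{i=1}^n s_i v_i v_iᵀ) ≥ (1 − √(k/r))² and λ_1(Σ_{i=1}^n s_i u_i u_iᵀ) ≤ (1 + √(ℓ/r))². -/

import Mathlib

open Matrix MeasureTheory

noncomputable def frobSq {m n : Type*} [Fintype m] [Fintype n] (A : Matrix m n ℝ) : ℝ :=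
  ∑ i, ∑ j, A i j ^ 2

noncomputable def spec {m n : Type*} [Fintype m] [Fintype n] [DecidableEq n]
    (A : Matrix m n ℝ) : ℝ :=
  ‖LinearMap.toContinuousLinearMap (Matrix.toEuclideanLin A)‖

noncomputable def specErr {m n : Type*} [Fintype m] [Fintype n] [DecidableEq n]
    (A : Matrix m n ℝ) (k : ℕ) : ℝ :=
  sInf {e : ℝ | ∃ X : Matrix m n ℝ, X.rank ≤ k ∧ e = spec (A - X)}

noncomputable def frobSqErr {m n : Type*} [Fintype m] [Fintype n]
    (A : Matrix m n ℝ) (k : ℕ) : ℝ :=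
  sInf {e : ℝ | ∃ X : Matrix m n ℝ, X.rank ≤ k ∧ e = frobSq (A - X)}

noncomputable def specErrIn {m n r : Type*} [Fintype m] [Fintype n] [DecidableEq n]
    [Fintype r] (A : Matrix m n ℝ) (C : Matrix m r ℝ) (k : ℕ) : ℝ :=
  sInf {e : ℝ | ∃ X : Matrix m n ℝ, X.rank ≤ k ∧
    LinearMap.range X.mulVecLin ≤ LinearMap.range C.mulVecLin ∧ e = spec (A - X)}

noncomputable def frobSqErrIn {m n r : Type*} [Fintype m] [Fintype n] [Fintype r]
    (A : Matrix m n ℝ) (C : Matrix m r ℝ) (k : ℕ) : ℝ :=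
  sInf {e : ℝ | ∃ X : Matrix m n ℝ, X.rank ≤ k ∧
    LinearMap.range X.mulVecLin ≤ LinearMap.range C.mulVecLin ∧ e = frobSq (A - X)}

def IsMoorePenrose {m n : Type*} [Fintype m] [Fintype n]
    (M : Matrix m n ℝ) (P : Matrix n m ℝ) : Prop :=
  M * P * M = M ∧ P * M * P = P ∧ (M * P)ᵀ = M * P ∧ (P * M)ᵀ = P * M

section RankOneUpdate

variable {ι : Type*} [Fintype ι] [DecidableEq ι]

lemma Matrix.PosDef.exists_shift_trace_inv {M : Matrix ι ι ℝ} (hM : M.PosDef) :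
    ∃ d : ι → ℝ, (∀ i, 0 < d i) ∧ ∀ c : ℝ, (∀ i, 0 < d i + c) →
      (M + c • (1 : Matrix ι ι ℝ)).PosDef ∧
      (M + c • (1 : Matrix ι ι ℝ))⁻¹.trace = ∑ i, (d i + c)⁻¹ ∧
      ((M + c • (1 : Matrix ι ι ℝ))⁻¹ * (M + c • (1 : Matrix ι ι ℝ))⁻¹).trace
        = ∑ i, ((d i + c)⁻¹) ^ 2 := by
  refine ⟨hM.isHermitian.eigenvalues, hM.eigenvalues_pos, fun c hc => ?_⟩
  set d := hM.isHermitian.eigenvalues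
  set U : Matrix ι ι ℝ := (hM.isHermitian.eigenvectorUnitary).val
  have hU : U * star U = 1 := Unitary.coe_mul_star_self _
  have hU' : star U * U = 1 := Unitary.coe_star_mul_self _
  have hconj (a b : ι → ℝ) : (U * diagonal a * star U) * (U * diagonal b * star U)
      = U * diagonal (fun i => a i * b i) * star U := by
    rw [← diagonal_mul_diagonal]
    simp only [mul_assoc]
    rw [← mul_assoc (star U) U, hU', one_mul]
  have htr (a : ι → ℝ) : (U * diagonal a * star U).trace = ∑ i, a i := by
    rw [trace_mul_comm, ← mul_assoc, hU', one_mul, trace_diagonal]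
  have hMc : M + c • (1 : Matrix ι ι ℝ) = U * diagonal (fun i => d i + c) * star U := by
    have h1 : M = U * diagonal d * star U := by
      simpa using hM.isHermitian.spectral_theorem
    have h2 : diagonal (fun i => d i + c) = diagonal d + c • (1 : Matrix ι ι ℝ) := by
      rw [smul_one_eq_diagonal, diagonal_add]
    rw [h2, mul_add, add_mul, ← h1, mul_smul_comm, mul_one, smul_mul_assoc, hU]
  have hinv : (M + c • (1 : Matrix ι ι ℝ))⁻¹ = U * diagonal (fun i => (d i + c)⁻¹) * star U := by
    apply inv_eq_right_inv
    rw [hMc, hconj]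
    simp only [mul_inv_cancel₀ (hc _).ne', diagonal_one, mul_one, hU]
  refine ⟨?_, by rw [hinv, htr], by rw [hinv, hconj, htr]; simp only [sq]⟩
  rw [hMc]
  have hinj : Function.Injective (star U).mulVec :=
    Function.LeftInverse.injective (g := U.mulVec) fun x => by rw [mulVec_mulVec, hU, one_mulVec]
  simpa [star_eq_conjTranspose] using
    (PosDef.diagonal hc).conjTranspose_mul_mul_same (B := star U) hinj

lemma Matrix.PosDef.add_smul_vecMulVec {N : Matrix ι ι ℝ} (hN : N.PosDef) (v : ι → ℝ) {t : ℝ}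
    (ht : 0 < 1 + t * (N⁻¹ *ᵥ v ⬝ᵥ v)) :
    (N + t • vecMulVec v v).PosDef ∧
      (N + t • vecMulVec v v)⁻¹.trace =
        N⁻¹.trace - t / (1 + t * (N⁻¹ *ᵥ v ⬝ᵥ v)) * (N⁻¹ *ᵥ v ⬝ᵥ N⁻¹ *ᵥ v) := by
  set y := N⁻¹ *ᵥ v with hy
  set q := y ⬝ᵥ v with hq
  have hdet : IsUnit N.det := (isUnit_iff_isUnit_det N).1 hN.isUnit
  have hNy : N *ᵥ y = v := by rw [hy, mulVec_mulVec, mul_nonsing_inv _ hdet, one_mulVec]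
  have hNT : Nᵀ = N := by simpa using hN.isHermitian.eq
  have hyN : v ᵥ* N⁻¹ = y := by rw [← mulVec_transpose, transpose_nonsing_inv, hNT]
  constructor
  · refine PosDef.of_dotProduct_mulVec_pos ?_ fun x hx => ?_
    · refine hN.isHermitian.add ?_
      ext i j
      simp [vecMulVec_apply, mul_comm]
    · have hx0 : 0 < x ⬝ᵥ N *ᵥ x := by simpa using hN.dotProduct_mulVec_pos hx
      have hxy : y ⬝ᵥ N *ᵥ x = x ⬝ᵥ v := by
        rw [dotProduct_mulVec, ← mulVec_transpose, hNT, hNy, dotProduct_comm]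
      have hquad (c : ℝ) : 0 ≤ x ⬝ᵥ N *ᵥ x - 2 * c * (x ⬝ᵥ v) + c ^ 2 * q := by
        have := hN.posSemidef.dotProduct_mulVec_nonneg (x - c • y)
        simp only [star_trivial, mulVec_sub, mulVec_smul, hNy, sub_dotProduct, dotProduct_sub,
          smul_dotProduct, dotProduct_smul, smul_eq_mul, hxy] at this
        linarith
      have hcs : (x ⬝ᵥ v) ^ 2 ≤ q * (x ⬝ᵥ N *ᵥ x) := by
        have := discrim_le_zero (a := q) (b := -2 * (x ⬝ᵥ v)) (c := x ⬝ᵥ N *ᵥ x)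
          fun c => by linarith [hquad c]
        rw [discrim] at this
        linarith
      have hgoal : star x ⬝ᵥ (N + t • vecMulVec v v) *ᵥ x
          = x ⬝ᵥ N *ᵥ x + t * (x ⬝ᵥ v) ^ 2 := by
        simp only [star_trivial, add_mulVec, smul_mulVec, vecMulVec_mulVec, dotProduct_add,
          dotProduct_smul, op_smul_eq_smul, smul_eq_mul, dotProduct_comm v x]
        ring
      rw [hgoal]
      rcases le_total 0 t with h | h
      · positivity
      · nlinarith [mul_pos ht hx0]
  · have hinv : (N + t • vecMulVec v v)⁻¹ = N⁻¹ - (t / (1 + t * q)) • vecMulVec y y := by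
      apply inv_eq_right_inv
      set c := t / (1 + t * q) with hc
      have hct : t - c - t * c * q = 0 := by rw [hc]; field_simp; ring
      have : (N + t • vecMulVec v v) * (N⁻¹ - c • vecMulVec y y)
          = 1 + (t - c - t * c * q) • vecMulVec v y := by
        rw [add_mul, mul_sub, mul_sub, mul_nonsing_inv _ hdet, mul_smul_comm, mul_vecMulVec, hNy,
          smul_mul_assoc, vecMulVec_mul, hyN, smul_mul_smul_comm, vecMulVec_mul_vecMulVec,
          dotProduct_comm v y, vecMulVec_smul]
        module
      rw [this, hct, zero_smul, add_zero]
    rw [hinv, trace_sub, trace_smul, trace_vecMulVec, smul_eq_mul]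

lemma Matrix.sum_mulVec_dotProduct_eq_trace {κ : Type*} [Fintype κ] {v : κ → ι → ℝ}
    (hv : ∑ i, vecMulVec (v i) (v i) = 1) (X : Matrix ι ι ℝ) :
    ∑ i, X *ᵥ v i ⬝ᵥ v i = X.trace := by
  conv_rhs => rw [← mul_one X, ← hv, Matrix.mul_sum, trace_sum]
  simp only [mul_vecMulVec, trace_vecMulVec]

lemma Matrix.IsHermitian.sum_mulVec_dotProduct_mulVec_eq_trace {κ : Type*} [Fintype κ]
    {v : κ → ι → ℝ} (hv : ∑ i, vecMulVec (v i) (v i) = 1) {X : Matrix ι ι ℝ}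
    (hX : X.IsHermitian) :
    ∑ i, X *ᵥ v i ⬝ᵥ X *ᵥ v i = (X * X).trace := by
  rw [← sum_mulVec_dotProduct_eq_trace hv]
  refine Finset.sum_congr rfl fun i _ => ?_
  have hXT : Xᵀ = X := by simpa using hX.eq
  rw [dotProduct_mulVec, ← mulVec_transpose, hXT, mulVec_mulVec]

lemma Matrix.IsHermitian.le_eigenvalues {A : Matrix ι ι ℝ} (hA : A.IsHermitian) {a : ℝ}
    (h : (A - a • (1 : Matrix ι ι ℝ)).PosSemidef) (j : ι) : a ≤ hA.eigenvalues j := by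
  have hx := h.dotProduct_mulVec_nonneg (hA.eigenvectorBasis j).ofLp
  have h1 : (hA.eigenvectorBasis j).ofLp ⬝ᵥ (hA.eigenvectorBasis j).ofLp = 1 :=
    hA.eigenvectorBasis.inner_eq_one j
  rw [hA.eigenvalues_eq]
  simp only [star_trivial, sub_mulVec, dotProduct_sub, smul_mulVec, one_mulVec, dotProduct_smul,
    h1, smul_eq_mul, mul_one] at hx
  simpa using hx

lemma Matrix.IsHermitian.eigenvalues_le {A : Matrix ι ι ℝ} (hA : A.IsHermitian) {a : ℝ}
    (h : (a • (1 : Matrix ι ι ℝ) - A).PosSemidef) (j : ι) : hA.eigenvalues j ≤ a := by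
  have hx := h.dotProduct_mulVec_nonneg (hA.eigenvectorBasis j).ofLp
  have h1 : (hA.eigenvectorBasis j).ofLp ⬝ᵥ (hA.eigenvectorBasis j).ofLp = 1 :=
    hA.eigenvectorBasis.inner_eq_one j
  rw [hA.eigenvalues_eq]
  simp only [star_trivial, sub_mulVec, dotProduct_sub, smul_mulVec, one_mulVec, dotProduct_smul,
    h1, smul_eq_mul, mul_one] at hx
  simpa using hx

end RankOneUpdate

section BarrierStep

variable {ι κ : Type*} [Fintype ι] [DecidableEq ι] [Fintype κ] [DecidableEq κ]

lemma Matrix.PosDef.trace_inv_shift_add [Nonempty ι] {M : Matrix ι ι ℝ} (hM : M.PosDef) {δ : ℝ}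
    (hδ : 0 < δ) {N : Matrix ι ι ℝ} (hN : N = M + δ • (1 : Matrix ι ι ℝ)) :
    N.PosDef ∧ 0 < M⁻¹.trace - N⁻¹.trace ∧
      (N⁻¹ * N⁻¹).trace / (M⁻¹.trace - N⁻¹.trace) + N⁻¹.trace ≤ 1 / δ + M⁻¹.trace := by
  obtain ⟨d, hd, h⟩ := hM.exists_shift_trace_inv
  obtain ⟨-, h0, -⟩ := h 0 (by simpa using hd)
  obtain ⟨hpos, h1, h2⟩ := h δ fun i => add_pos (hd i) hδ
  rw [zero_smul, add_zero] at h0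
  rw [← hN] at hpos h1 h2
  rw [h0, h1, h2]
  simp only [add_zero]
  have hdδ (i : ι) : 0 < d i + δ := add_pos (hd i) hδ
  have hD : ∑ i, (d i)⁻¹ - ∑ i, (d i + δ)⁻¹ = ∑ i, δ * ((d i)⁻¹ * (d i + δ)⁻¹) := by
    rw [← Finset.sum_sub_distrib]
    refine Finset.sum_congr rfl fun i _ => ?_
    have := hd i
    have := hdδ i
    field_simp
    ring
  have hDpos : 0 < ∑ i, (d i)⁻¹ - ∑ i, (d i + δ)⁻¹ := by
    rw [hD]
    exact Finset.sum_pos (fun i _ => mul_pos hδ (mul_pos (inv_pos.2 (hd i)) (inv_pos.2 (hdδ i))))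
      Finset.univ_nonempty
  refine ⟨hpos, hDpos, ?_⟩
  have hle : δ * ∑ i, ((d i + δ)⁻¹) ^ 2 ≤ ∑ i, (d i)⁻¹ - ∑ i, (d i + δ)⁻¹ := by
    rw [hD, Finset.mul_sum]
    refine Finset.sum_le_sum fun i _ => ?_
    have := inv_pos.2 (hdδ i)
    have : (d i + δ)⁻¹ ≤ (d i)⁻¹ := inv_anti₀ (hd i) (by linarith)
    rw [sq]
    gcongr
  have : (∑ i, ((d i + δ)⁻¹) ^ 2) / (∑ i, (d i)⁻¹ - ∑ i, (d i + δ)⁻¹) ≤ 1 / δ := by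
    rw [div_le_div_iff₀ hDpos hδ]
    linarith
  linarith

lemma Matrix.PosDef.trace_inv_shift_sub [Nonempty ι] {M : Matrix ι ι ℝ} (hM : M.PosDef)
    (hM1 : M⁻¹.trace < 1) {N : Matrix ι ι ℝ} (hN : N = M - 1) :
    N.PosDef ∧ 0 < N⁻¹.trace - M⁻¹.trace ∧
      1 - M⁻¹.trace ≤ (N⁻¹ * N⁻¹).trace / (N⁻¹.trace - M⁻¹.trace) - N⁻¹.trace := by
  obtain ⟨d, hd, h⟩ := hM.exists_shift_trace_inv
  obtain ⟨-, h0, -⟩ := h 0 (by simpa using hd)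
  rw [zero_smul, add_zero] at h0
  simp only [add_zero] at h0
  have hd1 (i : ι) : 0 < d i + -1 := by
    have : (d i)⁻¹ ≤ ∑ i, (d i)⁻¹ :=
      Finset.single_le_sum (f := fun i => (d i)⁻¹) (fun i _ => (inv_pos.2 (hd i)).le)
        (Finset.mem_univ i)
    have : 1 < d i := (inv_lt_one₀ (hd i)).1 (by linarith)
    linarith
  obtain ⟨hpos, h1, h2⟩ := h (-1) hd1
  rw [neg_one_smul, ← sub_eq_add_neg, ← hN] at hpos h1 h2
  rw [h0] at hM1
  rw [h0, h1, h2]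
  have hD : ∑ i, (d i + -1)⁻¹ - ∑ i, (d i)⁻¹ = ∑ i, (d i)⁻¹ * (d i + -1)⁻¹ := by
    rw [← Finset.sum_sub_distrib]
    refine Finset.sum_congr rfl fun i _ => ?_
    have := (hd i).ne'
    have := (hd1 i).ne'
    field_simp
    ring
  have hDpos : 0 < ∑ i, (d i + -1)⁻¹ - ∑ i, (d i)⁻¹ := by
    rw [hD]
    exact Finset.sum_pos (fun i _ => mul_pos (inv_pos.2 (hd i)) (inv_pos.2 (hd1 i)))
      Finset.univ_nonempty
  refine ⟨hpos, hDpos, ?_⟩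
  have hcs : (∑ i, (d i)⁻¹ * (d i + -1)⁻¹) ^ 2
      ≤ (∑ i, (d i)⁻¹) * ∑ i, (d i)⁻¹ * ((d i + -1)⁻¹) ^ 2 := by
    refine Finset.sum_sq_le_sum_mul_sum_of_sq_le_mul _ (fun i _ => (inv_pos.2 (hd i)).le)
      (fun i _ => mul_nonneg (inv_pos.2 (hd i)).le (sq_nonneg _)) fun i _ => le_of_eq (by ring)
  have hdiff : ∑ i, (d i)⁻¹ * ((d i + -1)⁻¹) ^ 2
      = ∑ i, ((d i + -1)⁻¹) ^ 2 - ∑ i, (d i)⁻¹ * (d i + -1)⁻¹ := by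
    rw [← Finset.sum_sub_distrib]
    refine Finset.sum_congr rfl fun i _ => ?_
    have := (hd i).ne'
    have := (hd1 i).ne'
    field_simp
    ring
  have hnn : 0 ≤ ∑ i, (d i)⁻¹ * ((d i + -1)⁻¹) ^ 2 :=
    Finset.sum_nonneg fun i _ => mul_nonneg (inv_pos.2 (hd i)).le (sq_nonneg _)
  rw [le_sub_iff_add_le, le_div_iff₀ hDpos]
  have hsum : 1 - ∑ i, (d i)⁻¹ + ∑ i, (d i + -1)⁻¹ = 1 + ∑ i, (d i)⁻¹ * (d i + -1)⁻¹ := by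
    rw [← hD]
    ring
  rw [hsum, hD]
  nlinarith

lemma Matrix.PosDef.lower_barrier_update {M N : Matrix ι ι ℝ} (hN : N.PosDef) {v : ι → ℝ} {a : ℝ}
    (hD : 0 < N⁻¹.trace - M⁻¹.trace) (ha : 0 < a)
    (hav : a = (N⁻¹ *ᵥ v ⬝ᵥ N⁻¹ *ᵥ v) / (N⁻¹.trace - M⁻¹.trace) - N⁻¹ *ᵥ v ⬝ᵥ v) :
    (N + a⁻¹ • vecMulVec v v).PosDef ∧ (N + a⁻¹ • vecMulVec v v)⁻¹.trace ≤ M⁻¹.trace := by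
  have hq : 0 ≤ N⁻¹ *ᵥ v ⬝ᵥ v := by
    simpa [dotProduct_comm] using hN.inv.posSemidef.dotProduct_mulVec_nonneg v
  obtain ⟨h1, h2⟩ := hN.add_smul_vecMulVec v (t := a⁻¹) (by positivity)
  refine ⟨h1, ?_⟩
  rw [h2]
  have : a⁻¹ / (1 + a⁻¹ * (N⁻¹ *ᵥ v ⬝ᵥ v)) * (N⁻¹ *ᵥ v ⬝ᵥ N⁻¹ *ᵥ v)
      = N⁻¹.trace - M⁻¹.trace := by
    have hs : N⁻¹ *ᵥ v ⬝ᵥ N⁻¹ *ᵥ v = (N⁻¹.trace - M⁻¹.trace) * (a + N⁻¹ *ᵥ v ⬝ᵥ v) := by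
      rw [hav]
      field_simp
      ring
    have : a + N⁻¹ *ᵥ v ⬝ᵥ v ≠ 0 := by positivity
    rw [hs]
    field_simp
  linarith

lemma Matrix.PosDef.upper_barrier_update {M N : Matrix ι ι ℝ} (hN : N.PosDef) {u : ι → ℝ} {a : ℝ}
    (hD : 0 < M⁻¹.trace - N⁻¹.trace) (ha : 0 < a)
    (hau : (N⁻¹ *ᵥ u ⬝ᵥ N⁻¹ *ᵥ u) / (M⁻¹.trace - N⁻¹.trace) + N⁻¹ *ᵥ u ⬝ᵥ u ≤ a) :
    (N - a⁻¹ • vecMulVec u u).PosDef ∧ (N - a⁻¹ • vecMulVec u u)⁻¹.trace ≤ M⁻¹.trace := by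
  have hs : 0 ≤ N⁻¹ *ᵥ u ⬝ᵥ N⁻¹ *ᵥ u := by
    simpa using dotProduct_star_self_nonneg (N⁻¹ *ᵥ u)
  have hlt : 0 < a - N⁻¹ *ᵥ u ⬝ᵥ u := by
    rcases hs.eq_or_lt with h | h
    · rw [dotProduct_self_eq_zero.1 h.symm]
      simpa using ha
    · have := div_pos h hD
      linarith
  have hden : 1 + -a⁻¹ * (N⁻¹ *ᵥ u ⬝ᵥ u) = a⁻¹ * (a - N⁻¹ *ᵥ u ⬝ᵥ u) := by
    field_simp
    ring
  obtain ⟨h1, h2⟩ := hN.add_smul_vecMulVec u (t := -a⁻¹) (by rw [hden]; positivity)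
  rw [neg_smul, ← sub_eq_add_neg] at h1 h2
  refine ⟨h1, ?_⟩
  have hle : (N⁻¹ *ᵥ u ⬝ᵥ N⁻¹ *ᵥ u) / (a - N⁻¹ *ᵥ u ⬝ᵥ u) ≤ M⁻¹.trace - N⁻¹.trace := by
    rw [div_le_iff₀ hlt, ← div_le_iff₀' hD]
    linarith
  have : -a⁻¹ / (a⁻¹ * (a - N⁻¹ *ᵥ u ⬝ᵥ u)) * (N⁻¹ *ᵥ u ⬝ᵥ N⁻¹ *ᵥ u)
      = -((N⁻¹ *ᵥ u ⬝ᵥ N⁻¹ *ᵥ u) / (a - N⁻¹ *ᵥ u ⬝ᵥ u)) := by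
    field_simp
  rw [h2, hden, this]
  linarith

lemma Finset.exists_le_and_pos_of_sum_le {α : Type*} {s : Finset α} {a b : α → ℝ}
    (hb : ∀ i ∈ s, 0 ≤ b i) (hab : ∑ i ∈ s, b i ≤ ∑ i ∈ s, a i) (ha : 0 < ∑ i ∈ s, a i) :
    ∃ i ∈ s, b i ≤ a i ∧ 0 < a i := by
  by_contra! h
  have hle : ∀ i ∈ s, a i ≤ b i := fun i hi => by
    by_contra! hlt
    linarith [h i hi hlt.le, hb i hi]
  obtain ⟨i, hi, hpos⟩ : ∃ i ∈ s, 0 < a i := by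
    by_contra! h'
    linarith [Finset.sum_nonpos h']
  refine (Finset.sum_lt_sum hle ⟨i, hi, ?_⟩).not_ge hab
  by_contra! hba
  linarith [h i hi hba]

lemma exists_dual_barrier_update [Nonempty ι] [Nonempty κ] {α : Type*} [Fintype α]
    {v : α → ι → ℝ} {u : α → κ → ℝ}
    (hv : ∑ i, vecMulVec (v i) (v i) = 1) (hu : ∑ i, vecMulVec (u i) (u i) = 1)
    {M : Matrix ι ι ℝ} {K : Matrix κ κ ℝ} (hM : M.PosDef) (hK : K.PosDef) {δ : ℝ} (hδ : 0 < δ)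
    (hM1 : M⁻¹.trace < 1) (hMK : 1 / δ + K⁻¹.trace ≤ 1 - M⁻¹.trace) :
    ∃ i, ∃ t : ℝ, 0 ≤ t ∧
      (M - 1 + t • vecMulVec (v i) (v i)).PosDef ∧
      (M - 1 + t • vecMulVec (v i) (v i))⁻¹.trace ≤ M⁻¹.trace ∧
      (K + δ • (1 : Matrix κ κ ℝ) - t • vecMulVec (u i) (u i)).PosDef ∧
      (K + δ • (1 : Matrix κ κ ℝ) - t • vecMulVec (u i) (u i))⁻¹.trace ≤ K⁻¹.trace := by
  obtain ⟨hN, hND, hNle⟩ := hM.trace_inv_shift_sub hM1 rfl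
  obtain ⟨hL, hLD, hLle⟩ := hK.trace_inv_shift_add hδ rfl
  set N := M - 1
  set L := K + δ • (1 : Matrix κ κ ℝ)
  have hsumv : ∑ i, ((N⁻¹ *ᵥ v i ⬝ᵥ N⁻¹ *ᵥ v i) / (N⁻¹.trace - M⁻¹.trace) - N⁻¹ *ᵥ v i ⬝ᵥ v i)
      = (N⁻¹ * N⁻¹).trace / (N⁻¹.trace - M⁻¹.trace) - N⁻¹.trace := by
    rw [Finset.sum_sub_distrib, ← Finset.sum_div, sum_mulVec_dotProduct_eq_trace hv,
      hN.inv.isHermitian.sum_mulVec_dotProduct_mulVec_eq_trace hv]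
  have hsumu : ∑ i, ((L⁻¹ *ᵥ u i ⬝ᵥ L⁻¹ *ᵥ u i) / (K⁻¹.trace - L⁻¹.trace) + L⁻¹ *ᵥ u i ⬝ᵥ u i)
      = (L⁻¹ * L⁻¹).trace / (K⁻¹.trace - L⁻¹.trace) + L⁻¹.trace := by
    rw [Finset.sum_add_distrib, ← Finset.sum_div, sum_mulVec_dotProduct_eq_trace hu,
      hL.inv.isHermitian.sum_mulVec_dotProduct_mulVec_eq_trace hu]
  obtain ⟨i, -, hle, hpos⟩ := Finset.exists_le_and_pos_of_sum_le (s := Finset.univ)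
    (a := fun i => (N⁻¹ *ᵥ v i ⬝ᵥ N⁻¹ *ᵥ v i) / (N⁻¹.trace - M⁻¹.trace) - N⁻¹ *ᵥ v i ⬝ᵥ v i)
    (b := fun i => (L⁻¹ *ᵥ u i ⬝ᵥ L⁻¹ *ᵥ u i) / (K⁻¹.trace - L⁻¹.trace) + L⁻¹ *ᵥ u i ⬝ᵥ u i)
    (fun i _ => by
      have h1 : 0 ≤ L⁻¹ *ᵥ u i ⬝ᵥ u i := by
        simpa [dotProduct_comm] using hL.inv.posSemidef.dotProduct_mulVec_nonneg (u i)
      have h2 : 0 ≤ L⁻¹ *ᵥ u i ⬝ᵥ L⁻¹ *ᵥ u i := by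
        simpa using dotProduct_star_self_nonneg (L⁻¹ *ᵥ u i)
      positivity)
    (by rw [hsumv, hsumu]; linarith)
    (by rw [hsumv]; linarith)
  obtain ⟨h1, h2⟩ := hN.lower_barrier_update hND hpos rfl
  obtain ⟨h3, h4⟩ := hL.upper_barrier_update hLD hpos hle
  exact ⟨i, _, (inv_pos.2 hpos).le, h1, h2, h3, h4⟩

lemma Matrix.trace_inv_smul_one (c : ℝ) :
    (c • (1 : Matrix ι ι ℝ))⁻¹.trace = Fintype.card ι / c := by
  rcases eq_or_ne c 0 with rfl | hc
  · simp
  · have : (c • (1 : Matrix ι ι ℝ))⁻¹ = c⁻¹ • (1 : Matrix ι ι ℝ) := by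
      apply inv_eq_right_inv
      rw [smul_mul_smul_comm, mul_inv_cancel₀ hc, one_smul, one_mul]
    rw [this, trace_smul, trace_one, smul_eq_mul, inv_mul_eq_div]

lemma sum_add_single_smul {α E : Type*} [Fintype α] [DecidableEq α] [AddCommMonoid E] [Module ℝ E]
    (s : α → ℝ) (i : α) (t : ℝ) (w : α → E) :
    ∑ j, (s + Pi.single i t : α → ℝ) j • w j = ∑ j, s j • w j + t • w i := by
  simp only [Pi.add_apply, add_smul, Finset.sum_add_distrib, Pi.single_apply, ite_smul,
    zero_smul, Finset.sum_ite_eq', Finset.mem_univ, if_true]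

lemma exists_weights_of_barriers [Nonempty ι] [Nonempty κ] {α : Type*} [Fintype α] [DecidableEq α]
    {v : α → ι → ℝ} {u : α → κ → ℝ}
    (hv : ∑ i, vecMulVec (v i) (v i) = 1) (hu : ∑ i, vecMulVec (u i) (u i) = 1)
    {a b δ : ℝ} (ha : 0 < a) (hb : 0 < b) (hδ : 0 < δ)
    (ha1 : Fintype.card ι / a < 1)
    (hab : 1 / δ + Fintype.card κ / b ≤ 1 - Fintype.card ι / a) (m : ℕ) :
    ∃ s : α → ℝ, (∀ i, 0 ≤ s i) ∧ {i | s i ≠ 0}.ncard ≤ m ∧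
      (∑ i, s i • vecMulVec (v i) (v i) - (m - a) • (1 : Matrix ι ι ℝ)).PosDef ∧
      (∑ i, s i • vecMulVec (v i) (v i) - (m - a) • (1 : Matrix ι ι ℝ))⁻¹.trace
        ≤ Fintype.card ι / a ∧
      ((m * δ + b) • (1 : Matrix κ κ ℝ) - ∑ i, s i • vecMulVec (u i) (u i)).PosDef ∧
      ((m * δ + b) • (1 : Matrix κ κ ℝ) - ∑ i, s i • vecMulVec (u i) (u i))⁻¹.trace
        ≤ Fintype.card κ / b := by
  induction m with
  | zero =>
    refine ⟨0, fun _ => le_rfl, by simp, ?_⟩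
    simpa [trace_inv_smul_one] using And.intro (PosDef.one.smul ha) (PosDef.one.smul hb)
  | succ m ih =>
    obtain ⟨s, hs, hcard, hM, hMtr, hK, hKtr⟩ := ih
    obtain ⟨i, t, ht, h1, h2, h3, h4⟩ := exists_dual_barrier_update hv hu hM hK hδ
      (hMtr.trans_lt ha1) (by linarith)
    have hlow : ∑ j, (s + Pi.single i t : α → ℝ) j • vecMulVec (v j) (v j)
          - ((m + 1 : ℕ) - a) • (1 : Matrix ι ι ℝ)
        = ∑ j, s j • vecMulVec (v j) (v j) - (m - a) • (1 : Matrix ι ι ℝ) - 1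
          + t • vecMulVec (v i) (v i) := by
      rw [sum_add_single_smul]
      push_cast
      module
    have hupp : ((m + 1 : ℕ) * δ + b) • (1 : Matrix κ κ ℝ)
          - ∑ j, (s + Pi.single i t : α → ℝ) j • vecMulVec (u j) (u j)
        = (m * δ + b) • (1 : Matrix κ κ ℝ) - ∑ j, s j • vecMulVec (u j) (u j)
          + δ • (1 : Matrix κ κ ℝ) - t • vecMulVec (u i) (u i) := by
      rw [sum_add_single_smul]
      push_cast
      module
    refine ⟨s + Pi.single i t, fun j => ?_, ?_, ?_⟩
    · exact add_nonneg (hs j) ((Pi.single_nonneg.2 ht : (0 : α → ℝ) ≤ _) j)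
    · have hsub : {j | (s + Pi.single i t : α → ℝ) j ≠ 0} ⊆ insert i {j | s j ≠ 0} := by
        intro j hj
        by_cases hji : j = i
        · exact Or.inl hji
        · right
          simpa [hji] using hj
      exact (Set.ncard_le_ncard hsub (Set.toFinite _)).trans
        ((Set.ncard_insert_le _ _).trans (by omega))
    · rw [hlow, hupp]
      exact ⟨h1, h2.trans hMtr, h3, h4.trans hKtr⟩

end BarrierStep

lemma exists_weights_eigenvalue_bounds {ι κ α : Type*} [Fintype ι] [DecidableEq ι] [Fintype κ]
    [DecidableEq κ] [Fintype α] [Nonempty ι] [Nonempty κ] {v : α → ι → ℝ} {u : α → κ → ℝ}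
    (hv : ∑ i, vecMulVec (v i) (v i) = 1) (hu : ∑ i, vecMulVec (u i) (u i) = 1)
    {r : ℕ} (hr : Fintype.card ι < r) :
    ∃ s : α → ℝ, (∀ i, 0 ≤ s i) ∧ {i | s i ≠ 0}.ncard ≤ r ∧
      (∀ hA : (∑ i, s i • vecMulVec (v i) (v i)).IsHermitian,
        ∀ j, (1 - √(Fintype.card ι / r)) ^ 2 ≤ hA.eigenvalues j) ∧
      (∀ hB : (∑ i, s i • vecMulVec (u i) (u i)).IsHermitian,
        ∀ j, hB.eigenvalues j ≤ (1 + √(Fintype.card κ / r)) ^ 2) := by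
  classical
  have hι : (0 : ℝ) < Fintype.card ι := by exact_mod_cast Fintype.card_pos
  have hκ : (0 : ℝ) < Fintype.card κ := by exact_mod_cast Fintype.card_pos
  have hr' : (Fintype.card ι : ℝ) < r := by exact_mod_cast hr
  have hr0 : (0 : ℝ) < r := hι.trans hr'
  set x := √(Fintype.card ι / r : ℝ) with hx
  set y := √(Fintype.card κ / r : ℝ) with hy
  have hx0 : 0 < x := by positivity
  have hy0 : 0 < y := by positivity
  have hx1 : x < 1 := by
    rw [hx, Real.sqrt_lt' one_pos, one_pow, div_lt_one hr0]
    exact hr'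
  have hx1' : 0 < 1 - x := by linarith
  have hxι : (Fintype.card ι : ℝ) = x ^ 2 * r := by
    rw [hx, Real.sq_sqrt (by positivity)]
    field_simp
  have hyκ : (Fintype.card κ : ℝ) = y ^ 2 * r := by
    rw [hy, Real.sq_sqrt (by positivity)]
    field_simp
  have hιx : Fintype.card ι / (r * x) = x := by
    rw [hxι]
    field_simp
  have hκy : Fintype.card κ / ((1 + y) / (1 - x) * (r * y)) = y * (1 - x) / (1 + y) := by
    rw [hyκ]
    field_simp
  obtain ⟨s, hs, hcard, hA, -, hB, -⟩ := exists_weights_of_barriers hv hu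
    (a := r * x) (b := (1 + y) / (1 - x) * (r * y)) (δ := (1 + y) / (1 - x))
    (by positivity) (by positivity) (by positivity) (by rw [hιx]; exact hx1)
    (by
      rw [hιx, hκy]
      apply le_of_eq
      field_simp) r
  have hc : 0 ≤ (1 - x) / r := by positivity
  refine ⟨((1 - x) / r) • s, fun i => mul_nonneg hc (hs i), ?_, fun hA' j => ?_, fun hB' j => ?_⟩
  · refine (Set.ncard_le_ncard (fun i hi => ?_) (Set.toFinite _)).trans hcard
    exact right_ne_zero_of_mul hi
  · refine hA'.le_eigenvalues ?_ j
    have heq : (1 - x) ^ 2 = (1 - x) / r * (r - r * x) := by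
      field_simp
    have := hA.posSemidef.smul hc
    rw [smul_sub, Finset.smul_sum, smul_smul, ← heq] at this
    simpa only [Pi.smul_apply, smul_eq_mul, mul_smul] using this
  · refine hB'.eigenvalues_le ?_ j
    have heq : (1 + y) ^ 2
        = (1 - x) / r * (r * ((1 + y) / (1 - x)) + (1 + y) / (1 - x) * (r * y)) := by
      field_simp
    have := hB.posSemidef.smul hc
    rw [smul_sub, Finset.smul_sum, smul_smul, ← heq] at this
    simpa only [Pi.smul_apply, smul_eq_mul, mul_smul] using this

/-- **Dual Set Spectral Sparsification** (Lemma 3.5 of Boutsidis–Drineas–Magdon-Ismail):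
given two decompositions of the identity `∑ vᵢvᵢᵀ = I_k` and `∑ uᵢuᵢᵀ = I_ℓ`
(`k < n`, `ℓ ≤ n`) and `k < r ≤ n`, there are nonnegative weights `sᵢ`, at most `r` of
which are nonzero, with `λ_min(∑ sᵢvᵢvᵢᵀ) ≥ (1 - √(k/r))²` and
`λ_max(∑ sᵢuᵢuᵢᵀ) ≤ (1 + √(ℓ/r))²`. -/
theorem dual_set_spectral_sparsification
    {n k ℓ : ℕ} (hkn : k < n) (hln : ℓ ≤ n)
    (v : Fin n → Fin k → ℝ) (u : Fin n → Fin ℓ → ℝ)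
    (hv : ∑ i, Matrix.vecMulVec (v i) (v i) = 1)
    (hu : ∑ i, Matrix.vecMulVec (u i) (u i) = 1)
    (r : ℕ) (hkr : k < r) (hrn : r ≤ n) :
    ∃ s : Fin n → ℝ,
      (∀ i, 0 ≤ s i) ∧
      {i | s i ≠ 0}.ncard ≤ r ∧
      (∀ hA : (∑ i, s i • Matrix.vecMulVec (v i) (v i)).IsHermitian,
        ∀ j, (1 - Real.sqrt ((k : ℝ) / (r : ℝ))) ^ 2 ≤ hA.eigenvalues j) ∧
      (∀ hB : (∑ i, s i • Matrix.vecMulVec (u i) (u i)).IsHermitian,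
        ∀ j, hB.eigenvalues j ≤ (1 + Real.sqrt ((ℓ : ℝ) / (r : ℝ))) ^ 2) := by
  rcases Nat.eq_zero_or_pos k with rfl | hk
  · refine ⟨0, fun _ => le_rfl, by simp, fun _ j => j.elim0, fun hB j => ?_⟩
    refine hB.eigenvalues_le ?_ j
    simpa using PosSemidef.one.smul (sq_nonneg (1 + √(ℓ / r : ℝ)))
  have : Nonempty (Fin k) := ⟨⟨0, hk⟩⟩
  have hr : Fintype.card (Fin k) < r := by simpa using hkr
  rcases Nat.eq_zero_or_pos ℓ with rfl | hl
  · obtain ⟨s, hs, hcard, hA, -⟩ := exists_weights_eigenvalue_bounds hv hv hr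
    exact ⟨s, hs, hcard, by simpa using hA, fun _ j => j.elim0⟩
  · have : Nonempty (Fin ℓ) := ⟨⟨0, hl⟩⟩
    simpa using exists_weights_eigenvalue_bounds hv hu hr
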